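/- arXiv:2101.09218 — 2 statements merged into one kernel-verified Lean document; each statement's English description precedes it below -/
import Mathlib

section
/- Let n ≥ 3 be an integer, c : (0,∞) → ℝ continuous, and δ > 0 such that c(r) r² + (n−2)²/4 ≥ δ for all r > 0. Then for every smooth compactly supported v : (0,∞) → ℂ (with support a compact subset of (0,∞)), ∫₀^∞ ( |v'(r)|² + c(r) |v(r)|² ) r^{n−1} dr ≥ δ ∫₀^∞ |v(r)|² r^{n−3} dr. In particular the quadratic form of H_c is nonnegative. -/
open Set

/-- A function continuous on an open set is integrable if its support lies in a compact subset. -/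
theorem integrable_of_continuousOn_of_support_subset_isCompact {f : ℝ → ℝ} {s K : Set ℝ}
    (hf : ContinuousOn f s) (hK : IsCompact K) (hKs : K ⊆ s) (hsupp : Function.support f ⊆ K) :
    MeasureTheory.Integrable f :=
  (MeasureTheory.integrableOn_iff_integrable_of_support_subset hsupp).1
    ((hf.mono hKs).integrableOn_compact hK)

/-- The pointwise inequality `‖w + a r⁻¹ z‖² r ^ (k + 2) ≥ 0` behind Hardy's inequality. -/
theorem hardy_pointwise (z w : ℂ) (a r : ℝ) (k : ℕ) (hr : 0 < r) :
    0 ≤ ‖w‖ ^ 2 * r ^ (k + 2) + 2 * a * inner ℝ z w * r ^ (k + 1) + a ^ 2 * ‖z‖ ^ 2 * r ^ k := by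
  have h := norm_add_sq_real (r • w) (a • z)
  rw [norm_smul, norm_smul, mul_pow, mul_pow, Real.norm_eq_abs, Real.norm_eq_abs, sq_abs, sq_abs,
    real_inner_smul_left, real_inner_smul_right, real_inner_comm] at h
  have h' := mul_nonneg (sq_nonneg ‖r • w + a • z‖) (pow_pos hr k).le
  rw [h] at h'
  linear_combination h'

/-- positivity of the quadratic form of H_c: if c(r)r² + (n−2)²/4 ≥ δ > 0 then
∫(|v'|² + c|v|²) r^{n−1} dr ≥ δ ∫ |v|² r^{n−3} dr for smooth v compactly supported in (0,∞). -/
theorem stmt9 (n : ℕ) (hn : 3 ≤ n) (c : ℝ → ℝ) (hc : ContinuousOn c (Ioi 0))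
    (δ : ℝ) (hδ : 0 < δ)
    (hlb : ∀ r > 0, δ ≤ c r * r ^ 2 + ((n : ℝ) - 2) ^ 2 / 4)
    (v : ℝ → ℂ) (hv : ContDiff ℝ (⊤ : ℕ∞) v) (hvsupp : HasCompactSupport v)
    (hvsupp' : tsupport v ⊆ Ioi 0) :
    δ * ∫ r in Ioi (0:ℝ), ‖v r‖ ^ 2 * r ^ (n - 3)
      ≤ ∫ r in Ioi (0:ℝ), (‖deriv v r‖ ^ 2 + c r * ‖v r‖ ^ 2) * r ^ (n - 1) := by
  obtain ⟨k, rfl⟩ := Nat.exists_eq_add_of_le' hn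
  simp only [Nat.add_sub_cancel, show k + 3 - 1 = k + 2 from rfl]
  have hvc : Continuous v := hv.continuous
  have hdc : Continuous (deriv v) := hv.continuous_deriv (by simp)
  have hv0 : ∀ r ∉ tsupport v, v r = 0 := fun r hr ↦ image_eq_zero_of_notMem_tsupport hr
  have hd0 : ∀ r ∉ tsupport v, deriv v r = 0 := fun r hr ↦
    Function.notMem_support.1 fun h ↦ hr (support_deriv_subset h)
  have integrable {f : ℝ → ℝ} (hf : ContinuousOn f (Ioi 0)) (h0 : ∀ r ∉ tsupport v, f r = 0) :
      MeasureTheory.IntegrableOn f (Ioi 0) :=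
    (integrable_of_continuousOn_of_support_subset_isCompact hf hvsupp hvsupp'
      fun r hr ↦ by_contra fun h ↦ hr (h0 r h)).integrableOn
  set a : ℝ := ((k : ℝ) + 1) / 2 with ha
  set F : ℝ → ℝ := fun r ↦ ‖v r‖ ^ 2 * r ^ (k + 1) with hF
  have hFsmooth : ContDiff ℝ 1 F :=
    ((hv.of_le (by simp)).norm_sq ℝ).mul (contDiff_id.pow _)
  have hFsupp : HasCompactSupport F :=
    hvsupp.mono' fun r hr ↦ by_contra fun h ↦ hr (by simp [hF, hv0 r h])
  have hFderiv (r : ℝ) : deriv F r =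
      2 * inner ℝ (v r) (deriv v r) * r ^ (k + 1) + ‖v r‖ ^ 2 * ((k + 1) * r ^ k) := by
    have h1 := ((hv.differentiable (by simp)) r).hasDerivAt.norm_sq
    have h2 := h1.mul (hasDerivAt_pow (k + 1) r)
    rw [show deriv F r = _ from h2.deriv]
    push_cast [Nat.add_sub_cancel]
    rfl
  have hFint : ∫ r in Ioi (0 : ℝ), deriv F r = 0 := by
    rw [hFsupp.integral_Ioi_deriv_eq hFsmooth 0]
    simp [hF]
  have i1 : MeasureTheory.IntegrableOn (fun r ↦ ‖v r‖ ^ 2 * r ^ k) (Ioi 0) :=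
    integrable (by fun_prop) fun r hr ↦ by simp [hv0 r hr]
  have i2 : MeasureTheory.IntegrableOn
      (fun r ↦ (‖deriv v r‖ ^ 2 + c r * ‖v r‖ ^ 2) * r ^ (k + 2)) (Ioi 0) :=
    integrable (by fun_prop) fun r hr ↦ by simp [hv0 r hr, hd0 r hr]
  have i3 : MeasureTheory.IntegrableOn (deriv F) (Ioi 0) :=
    integrable (hFsmooth.continuous_deriv le_rfl).continuousOn fun r hr ↦ by
      simp [hFderiv, hv0 r hr]
  have key : ∫ r in Ioi (0 : ℝ), δ * (‖v r‖ ^ 2 * r ^ k) ≤ ∫ r in Ioi (0 : ℝ),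
      ((‖deriv v r‖ ^ 2 + c r * ‖v r‖ ^ 2) * r ^ (k + 2) + a * deriv F r) := by
    refine MeasureTheory.setIntegral_mono_on (i1.const_mul δ) (i2.add (i3.const_mul a))
      measurableSet_Ioi fun r hr ↦ ?_
    have hr : 0 < r := hr
    have h1 := hardy_pointwise (v r) (deriv v r) a r k hr
    have h2 : δ * (‖v r‖ ^ 2 * r ^ k) ≤ (c r * r ^ 2 + a ^ 2) * (‖v r‖ ^ 2 * r ^ k) := by
      refine mul_le_mul_of_nonneg_right ((hlb r hr).trans_eq ?_) (by positivity)
      push_cast [ha]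
      ring
    rw [hFderiv, show (k : ℝ) + 1 = 2 * a by rw [ha]; ring]
    linear_combination h1 + h2
  rwa [MeasureTheory.integral_const_mul, MeasureTheory.integral_add i2 (i3.const_mul a),
    MeasureTheory.integral_const_mul, hFint, mul_zero, add_zero] at key
end

section
/- Let μ₀ ∈ (1/2, ∞). Let φ₁ : [0,∞) → ℝ be continuously differentiable and nonnegative, with A_φ := sup_{r>0} |φ₁(r) + r φ₁'(r)| < ∞. Set φ(r) = r(1 + φ₁(r)) and V_μ(r) = μ/φ(r). Then for every r > 0 and each choice of sign ±: (a) if μ ≥ 2 and A_φ ≤ 1 then 1/4 + r²( V_μ(r)² ± V_μ'(r) ) ≥ 1/4; (b) if 1 ≤ μ < 2 then 1/4 + r²( V_μ(r)² ± V_μ'(r) ) ≥ 1/4 − 2 A_φ; (c) if μ₀ ≤ μ < 1 then 1/4 + r²( V_μ(r)² ± V_μ'(r) ) ≥ 1/4 + μ₀² − μ₀ − A_φ. -/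
open Set

theorem hasDerivAt_const_div_mul_one_add {f : ℝ → ℝ} {f' r : ℝ} (c : ℝ)
    (hf : HasDerivAt f f' r) (hr : r ≠ 0) (hu : 1 + f r ≠ 0) :
    HasDerivAt (fun s => c / (s * (1 + f s)))
      (-(c * (1 + (f r + r * f'))) / (r * (1 + f r)) ^ 2) r := by
  have hd : HasDerivAt (fun s => s * (1 + f s)) (1 * (1 + f r) + r * f') r :=
    (hasDerivAt_id' r).mul (hf.const_add 1)
  refine ((hasDerivAt_const r c).fun_div hd (mul_ne_zero hr hu)).congr_deriv ?_
  ring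

theorem le_div_of_le_of_nonpos_of_one_le {a b d : ℝ} (hab : a ≤ b) (ha : a ≤ 0) (hd : 1 ≤ d) :
    a ≤ b / d := by
  rw [le_div_iff₀ (by linarith)]
  nlinarith

/-- lower bounds for I(r) = 1/4 + r²(V_μ² ± V_μ') in the asymptotically flat
case φ(r) = r(1+φ₁(r)), with A_φ bounding |φ₁ + rφ₁'| on (0,∞), in the three regimes μ ≥ 2,
1 ≤ μ < 2 and μ₀ ≤ μ < 1. -/
theorem stmt12 (μ₀ : ℝ) (hμ₀ : 1/2 < μ₀) (φ₁ : ℝ → ℝ)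
    (hC1 : ContDiffOn ℝ 1 φ₁ (Ici 0)) (hnn : ∀ r ≥ 0, 0 ≤ φ₁ r)
    (Aφ : ℝ) (hA : ∀ r > 0, |φ₁ r + r * deriv φ₁ r| ≤ Aφ) (μ : ℝ) :
    ∀ r > 0, ∀ ε : ℝ, ε = 1 ∨ ε = -1 →
      ((2 ≤ μ → Aφ ≤ 1 →
          1/4 ≤ 1/4 + r ^ 2 * ((μ / (r * (1 + φ₁ r))) ^ 2
              + ε * deriv (fun s => μ / (s * (1 + φ₁ s))) r)) ∧
       (1 ≤ μ → μ < 2 →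
          1/4 - 2 * Aφ ≤ 1/4 + r ^ 2 * ((μ / (r * (1 + φ₁ r))) ^ 2
              + ε * deriv (fun s => μ / (s * (1 + φ₁ s))) r)) ∧
       (μ₀ ≤ μ → μ < 1 →
          1/4 + μ₀ ^ 2 - μ₀ - Aφ ≤ 1/4 + r ^ 2 * ((μ / (r * (1 + φ₁ r))) ^ 2
              + ε * deriv (fun s => μ / (s * (1 + φ₁ s))) r))) := by
  intro r hr ε hε
  have hu : 1 ≤ 1 + φ₁ r := by linarith [hnn r hr.le]
  have hu0 : 1 + φ₁ r ≠ 0 := by positivity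
  have hφ₁ : HasDerivAt φ₁ (deriv φ₁ r) r :=
    ((hC1.contDiffAt (Ici_mem_nhds hr)).differentiableAt one_ne_zero).hasDerivAt
  rw [(hasDerivAt_const_div_mul_one_add μ hφ₁ hr.ne' hu0).deriv]
  have hg := hA r hr
  generalize φ₁ r + r * deriv φ₁ r = g at hg ⊢
  have hformula : r ^ 2 * ((μ / (r * (1 + φ₁ r))) ^ 2
      + ε * (-(μ * (1 + g)) / (r * (1 + φ₁ r)) ^ 2))
      = (μ ^ 2 - ε * (μ * (1 + g))) / (1 + φ₁ r) ^ 2 := by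
    field_simp
    ring
  rw [hformula]
  have hu2 : 1 ≤ (1 + φ₁ r) ^ 2 := one_le_pow₀ hu
  have hA0 : 0 ≤ Aφ := (abs_nonneg g).trans hg
  obtain ⟨hg₁, hg₂⟩ := abs_le.mp hg
  have hεg : μ ≥ 0 → μ ^ 2 - μ - μ * Aφ ≤ μ ^ 2 - ε * (μ * (1 + g)) := by
    intro hμ
    rcases hε with rfl | rfl <;> nlinarith
  refine ⟨fun hμ hA1 => ?_, fun hμ hμ2 => ?_, fun hμ hμ1 => ?_⟩
  · have hnum : 0 ≤ μ ^ 2 - ε * (μ * (1 + g)) := by nlinarith [hεg (by linarith)]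
    linarith [le_div_of_le_of_nonpos_of_one_le hnum le_rfl hu2]
  · have hnum : -(2 * Aφ) ≤ μ ^ 2 - ε * (μ * (1 + g)) := by nlinarith [hεg (by linarith)]
    linarith [le_div_of_le_of_nonpos_of_one_le hnum (by linarith) hu2]
  · have hnum : μ₀ ^ 2 - μ₀ - Aφ ≤ μ ^ 2 - ε * (μ * (1 + g)) := by
      have h₁ : μ₀ ^ 2 - μ₀ ≤ μ ^ 2 - μ := by nlinarith
      have h₂ : μ * Aφ ≤ Aφ := by nlinarith
      linarith [hεg (by linarith)]
    linarith [le_div_of_le_of_nonpos_of_one_le hnum (by nlinarith) hu2]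
end
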